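/- Evaluation of the twisted column operators (Theorem 4.1): In the twisted column-operator model attached to a partition λ = (λ₁ ≥ … ≥ λ_r ≥ 0) with top-row parameters y₁, …, y_r, let S_r^λ = {σ ∈ S_r : λ_{σ(i)} = λ_i for all i}. Then |S_r^λ| · Z = Σ_{σ∈S_r} ∏_{i=1}^r y_{σ(i)}^{λ_i+1} · ∏_{(i,j) : λ_j > λ_i} (y_{σ(j)} − q·y_{σ(i)})/(y_{σ(j)} − y_{σ(i)}), where the second product is over ordered pairs (i,j) with 1 ≤ i, j ≤ r and λ_j > λ_i. Equivalently, Z = Σ over a set of coset representatives σ of S_r/S_r^λ of the (coset-independent) summand above. -/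

import Mathlib

noncomputable section

/-- A state of the twisted column-operator model of Theorem 4.1: rows `s = 0, …, 2r-1`
are numbered top to bottom, `m s c` is the multiplicity of the vertical edge above row
`s` in column `c` (so `m 0` is the top boundary and `m (2r)` the bottom boundary), and
`h s c` is the occupancy of the horizontal edge to the left of column `c` in row `s`. -/
structure TwState (r : ℕ) (lam : Fin r → ℕ) (L : ℕ) where
  m : Fin (2*r+1) → Fin (L+1) → ℕ
  h : Fin (2*r) → Fin (L+2) → Bool
  mtop : ∀ c : Fin (L+1), m 0 c = 0
  mbot : ∀ c : Fin (L+1),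
    m (Fin.last (2*r)) c = (Finset.univ.filter (fun i => lam i = c.val)).card
  hleft : ∀ s : Fin (2*r), h s 0 = decide (s.val < r)
  hright : ∀ s : Fin (2*r), h s (Fin.last (L+1)) = false

/-- The (nonlocal) Boltzmann weight of the vertex in row `s` and column `c` of a state
of the twisted column-operator model, with row parameters `p`.  Here the top multiplicity
is `m s c`, the bottom one is `m (s+1) c`, and the `(1,1)` weight involves the set
`A_{s,c}` of rows `k ≠ s` whose vertex in column `c` has horizontal pattern `(1,0)` with
bottom multiplicity exceeding the top one by one. -/
def twLocal {F : Type} [Field F] {r : ℕ} {lam : Fin r → ℕ} {L : ℕ}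
    (q : F) (p : Fin (2*r) → F) (st : TwState r lam L)
    (s : Fin (2*r)) (c : Fin (L+1)) : F :=
  match st.h s c.castSucc, st.h s c.succ with
  | false, false => if st.m s.castSucc c = st.m s.succ c then 1 else 0
  | true, true =>
      if st.m s.castSucc c = st.m s.succ c then
        p s * ∏ k ∈ Finset.univ.filter
            (fun k : Fin (2*r) => k ≠ s ∧ st.h k c.castSucc = true ∧
              st.h k c.succ = false ∧ st.m k.succ c = st.m k.castSucc c + 1),
          (p s - q * p k) / (p s - p k)
      else 0
  | false, true => 0
  | true, false => if st.m s.succ c = st.m s.castSucc c + 1 then p s else 0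

/-- The partition function of the twisted column-operator model. -/
def ZTw {F : Type} [Field F] (r : ℕ) (lam : Fin r → ℕ) (L : ℕ)
    (q : F) (p : Fin (2*r) → F) : F :=
  ∑ᶠ st : TwState r lam L, ∏ s : Fin (2*r), ∏ c : Fin (L+1), twLocal q p st s c


/-- Functions with the same fibre cardinalities as `lam`. -/
def TwT (r : ℕ) (lam : Fin r → ℕ) (L : ℕ) : Type :=
  {f : Fin r → Fin (L+1) // ∀ c : Fin (L+1),
    (Finset.univ.filter (fun i => f i = c)).card =
      (Finset.univ.filter (fun i => lam i = c.val)).card}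

instance (r : ℕ) (lam : Fin r → ℕ) (L : ℕ) : Fintype (TwT r lam L) := by
  unfold TwT; infer_instance

instance (r : ℕ) (lam : Fin r → ℕ) (L : ℕ) : DecidableEq (TwT r lam L) := by
  unfold TwT; infer_instance

/-- Occupation count determined by `f`. -/
def twM {r L : ℕ} (f : Fin r → Fin (L+1)) (s : ℕ) (c : Fin (L+1)) : ℕ :=
  (Finset.univ.filter (fun k : Fin r => k.val < s ∧ f k = c)).card

/-- Horizontal labels determined by `f`. -/
def twH {r L : ℕ} (f : Fin r → Fin (L+1)) (s : ℕ) (j : ℕ) : Bool :=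
  if hs : s < r then decide (j ≤ (f ⟨s, hs⟩).val) else false

lemma twM_zero {r L : ℕ} (f : Fin r → Fin (L+1)) (c : Fin (L+1)) : twM f 0 c = 0 := by
  simp [twM]

lemma twM_top {r L : ℕ} (f : Fin r → Fin (L+1)) (s : ℕ) (hs : r ≤ s) (c : Fin (L+1)) :
    twM f s c = (Finset.univ.filter (fun k : Fin r => f k = c)).card := by
  unfold twM
  congr 1
  ext k
  have := k.isLt
  simp only [Finset.mem_filter, Finset.mem_univ, true_and]
  constructor
  · exact fun h => h.2
  · exact fun h => ⟨by omega, h⟩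

lemma twM_succ_lt {r L : ℕ} (f : Fin r → Fin (L+1)) (s : ℕ) (hs : s < r) (c : Fin (L+1)) :
    twM f (s+1) c = twM f s c + if f ⟨s, hs⟩ = c then 1 else 0 := by
  unfold twM
  split_ifs with h
  · have : (Finset.univ.filter (fun k : Fin r => k.val < s + 1 ∧ f k = c)) =
      insert ⟨s, hs⟩ (Finset.univ.filter (fun k : Fin r => k.val < s ∧ f k = c)) := by
      ext k
      simp only [Finset.mem_filter, Finset.mem_univ, true_and, Finset.mem_insert]
      constructor
      · rintro ⟨h1, h2⟩
        rcases Nat.lt_succ_iff_lt_or_eq.mp h1 with h3 | h3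
        · exact Or.inr ⟨h3, h2⟩
        · exact Or.inl (Fin.ext h3)
      · rintro (h1 | ⟨h1, h2⟩)
        · subst h1; exact ⟨Nat.lt_succ_self _, h⟩
        · exact ⟨by omega, h2⟩
    rw [this, Finset.card_insert_of_notMem (by simp)]
  · rw [add_zero]
    congr 1
    ext k
    simp only [Finset.mem_filter, Finset.mem_univ, true_and]
    constructor
    · rintro ⟨h1, h2⟩
      refine ⟨?_, h2⟩
      rcases Nat.lt_succ_iff_lt_or_eq.mp h1 with h3 | h3
      · exact h3
      · exact absurd (by rw [← h2]; congr 1; exact Fin.ext h3.symm) h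
    · rintro ⟨h1, h2⟩
      exact ⟨by omega, h2⟩

lemma twM_succ_ge {r L : ℕ} (f : Fin r → Fin (L+1)) (s : ℕ) (hs : r ≤ s) (c : Fin (L+1)) :
    twM f (s+1) c = twM f s c := by
  rw [twM_top f s hs, twM_top f (s+1) (by omega)]

/-- The state attached to `f`. -/
def twPhi {r : ℕ} {lam : Fin r → ℕ} {L : ℕ} (t : TwT r lam L) : TwState r lam L where
  m s c := twM t.1 s.val c
  h s j := twH t.1 s.val j.val
  mtop c := by simp [twM]
  mbot c := by
    rw [twM_top _ _ (by simp; omega)]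
    exact t.2 c
  hleft s := by
    unfold twH
    split_ifs with hs <;> simp [hs]
  hright s := by
    unfold twH
    split_ifs with hs
    · have := (t.1 ⟨s.val, hs⟩).isLt
      simp only [Fin.val_last, decide_eq_false_iff_not]
      omega
    · rfl

lemma twH_true {r L : ℕ} (f : Fin r → Fin (L+1)) (s j : ℕ) :
    twH f s j = true ↔ ∃ hs : s < r, j ≤ (f ⟨s, hs⟩).val := by
  unfold twH
  split_ifs with hs <;> simp [hs]

lemma twPhi_injective {r : ℕ} {lam : Fin r → ℕ} {L : ℕ} :
    Function.Injective (twPhi : TwT r lam L → TwState r lam L) := by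
  intro t t' htt
  apply Subtype.ext
  funext k
  have hk := k.isLt
  have key : ∀ j : Fin (L+2), twH t.1 k.val j.val = twH t'.1 k.val j.val := fun j =>
    congrFun (congrFun (congrArg TwState.h htt) ⟨k.val, by omega⟩) j
  have key2 : ∀ j : Fin (L+2), j.val ≤ (t.1 k).val ↔ j.val ≤ (t'.1 k).val := by
    intro j
    have := key j
    simpa [twH, hk] using this
  have a := (key2 (t.1 k).castSucc).1 (by simp)
  have b := (key2 (t'.1 k).castSucc).2 (by simp)
  simp only [Fin.val_castSucc] at a b
  exact Fin.ext (by omega)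

/-- Consequences of nonvanishing local weight. -/
lemma twLocal_ne {F : Type} [Field F] {r : ℕ} {lam : Fin r → ℕ} {L : ℕ}
    (q : F) (p : Fin (2*r) → F) (st : TwState r lam L)
    (s : Fin (2*r)) (c : Fin (L+1)) (h : twLocal q p st s c ≠ 0) :
    (st.h s c.succ = true → st.h s c.castSucc = true) ∧
    st.m s.succ c = st.m s.castSucc c +
      (if st.h s c.castSucc = true ∧ st.h s c.succ = false then 1 else 0) := by
  unfold twLocal at h
  cases h1 : st.h s c.castSucc <;> cases h2 : st.h s c.succ <;> simp [h1, h2] at h ⊢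
  · exact h.symm
  · exact h.1
  · exact h.1.symm

lemma tw_row {L : ℕ} (g : Fin (L+2) → Bool) (h0 : g 0 = true) (h1 : g (Fin.last (L+1)) = false)
    (hg : ∀ c : Fin (L+1), g c.succ = true → g c.castSucc = true) :
    ∃ c : Fin (L+1), ∀ j : Fin (L+2), g j = decide (j.val ≤ c.val) := by
  have anti : Antitone g := by
    rw [Fin.antitone_iff_succ_le]
    intro c
    have := hg c
    revert this
    cases g c.succ <;> cases g c.castSucc <;> simp
  have ex : ∃ n : ℕ, ∃ hn : n < L + 2, g ⟨n, hn⟩ = false := ⟨L+1, by omega, h1⟩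
  classical
  obtain ⟨hn, hf⟩ := Nat.find_spec ex
  have hpos : Nat.find ex ≠ 0 := by
    intro h
    have : (⟨Nat.find ex, hn⟩ : Fin (L+2)) = 0 := Fin.ext h
    rw [this, h0] at hf
    cases hf
  refine ⟨⟨Nat.find ex - 1, by omega⟩, fun j => ?_⟩
  by_cases hj : j.val < Nat.find ex
  · have := Nat.find_min ex hj
    have h3 : g j = true := by
      by_contra hc
      exact this ⟨j.isLt, by simpa using hc⟩
    rw [h3]; symm; simp only [decide_eq_true_eq]; omega
  · have h3 : g j ≤ g ⟨Nat.find ex, hn⟩ := anti (by rw [Fin.le_def]; simpa using hj)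
    rw [hf] at h3
    have h4 : g j = false := by
      revert h3; cases g j <;> decide
    rw [h4]; symm; simp only [decide_eq_false_iff_not]; omega

lemma tw_surj {F : Type} [Field F] {r : ℕ} {lam : Fin r → ℕ} {L : ℕ}
    (q : F) (p : Fin (2*r) → F) (st : TwState r lam L)
    (h : ∀ s c, twLocal q p st s c ≠ 0) : st ∈ Set.range (twPhi : TwT r lam L → _) := by
  have hh := fun s c => twLocal_ne q p st s c (h s c)
  have e1 : ∀ k : Fin r, ∃ c : Fin (L+1), ∀ j : Fin (L+2),
      st.h ⟨k.val, by omega⟩ j = decide (j.val ≤ c.val) := fun k =>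
    tw_row _ (by rw [st.hleft]; simp) (st.hright _) (fun c => (hh _ c).1)
  choose f hf using e1
  have hH : ∀ s j, st.h s j = twH f s.val j.val := by
    intro s j
    unfold twH
    split_ifs with hs
    · exact hf ⟨s.val, hs⟩ j
    · induction j using Fin.induction with
      | zero => rw [st.hleft]; simp [hs]
      | succ c ih =>
        by_contra hc
        have := (hh s c).1 (by simpa using hc)
        rw [ih] at this
        cases this
  have hM : ∀ s c, st.m s c = twM f s.val c := by
    intro s c
    induction s using Fin.induction with
    | zero => rw [st.mtop]; simp [twM]
    | succ s ih =>
      rw [(hh s c).2, ih, hH, hH]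
      simp only [Fin.val_castSucc, Fin.val_succ]
      by_cases hs : s.val < r
      · rw [twM_succ_lt f _ hs]
        congr 1
        simp only [twH, hs, dite_true, decide_eq_true_eq, decide_eq_false_iff_not]
        have : (c.val ≤ (f ⟨s.val, hs⟩).val ∧ ¬ c.val + 1 ≤ (f ⟨s.val, hs⟩).val) ↔
            f ⟨s.val, hs⟩ = c := by
          rw [Fin.ext_iff]; omega
        simp only [this]
      · rw [twM_succ_ge f _ (by omega)]
        simp [twH, hs]
  refine ⟨⟨f, fun c => ?_⟩, ?_⟩
  · rw [← st.mbot c, hM, twM_top _ _ (by simp; omega)]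
  · cases st with
    | mk m h' a b c d =>
      unfold twPhi
      congr
      · funext s c; exact (hM s c).symm
      · funext s c; exact (hH s c).symm

/-- Weight of a filling. -/
def twW {F : Type} [Field F] {r : ℕ} (q : F) (y : Fin r → F) (g : Fin r → ℕ) : F :=
  (∏ s, y s ^ (g s + 1)) * ∏ s, ∏ k, if g k < g s then (y s - q * y k) / (y s - y k) else 1

lemma twLocal_lt {F : Type} [Field F] {r : ℕ} {lam : Fin r → ℕ} {L : ℕ}
    (q : F) (y : Fin r → F)
    (p : Fin (2*r) → F) (hp : ∀ (s : Fin (2*r)) (hs : s.val < r), p s = y ⟨s.val, hs⟩)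
    (t : TwT r lam L) (s : Fin r) (c : Fin (L+1)) :
    twLocal q p (twPhi t) ⟨s.val, by omega⟩ c =
      (if c ≤ t.1 s then y s else 1) *
      ∏ k, if c < t.1 s ∧ c = t.1 k then (y s - q * y k) / (y s - y k) else 1 := by
  have hs := s.isLt
  have hps : p ⟨s.val, by omega⟩ = y s := hp ⟨s.val, by omega⟩ hs
  have hms := twM_succ_lt t.1 s.val hs c
  rcases lt_trichotomy c (t.1 s) with hc | hc | hc
  · have h1 : (twPhi t).h ⟨s.val, by omega⟩ c.castSucc = true :=
      (twH_true _ _ _).2 ⟨hs, by simpa using hc.le⟩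
    have h2 : (twPhi t).h ⟨s.val, by omega⟩ c.succ = true :=
      (twH_true _ _ _).2 ⟨hs, by simpa using hc⟩
    have h3 : (twPhi t).m (Fin.castSucc ⟨s.val, by omega⟩) c =
        (twPhi t).m (Fin.succ ⟨s.val, by omega⟩) c := by
      change twM t.1 s.val c = twM t.1 (s.val + 1) c
      rw [hms, if_neg (by exact hc.ne'), add_zero]
    unfold twLocal
    simp only [h1, h2, h3, if_true]
    rw [hps, if_pos hc.le, Finset.prod_filter]
    congr 1
    symm
    apply Fintype.prod_of_injective (fun k : Fin r => (⟨k.val, by omega⟩ : Fin (2*r)))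
    · intro a b hab
      simpa [Fin.ext_iff] using hab
    · intro k hk
      have hk' : ¬ k.val < r := fun hlt => hk ⟨⟨k.val, hlt⟩, rfl⟩
      rw [if_neg]
      rintro ⟨-, h, -⟩
      exact hk' ((twH_true _ _ _).1 h).1
    · intro k
      have hpk : p ⟨k.val, by omega⟩ = y k := hp ⟨k.val, by omega⟩ k.isLt
      simp only [hpk]
      refine if_congr ?_ rfl rfl
      have hmk := twM_succ_lt t.1 k.val k.isLt c
      constructor
      · rintro ⟨-, hck⟩
        refine ⟨?_, ?_, ?_, ?_⟩
        · intro hks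
          have : k = s := by simpa [Fin.ext_iff] using hks
          subst this
          exact hc.ne hck
        · exact (twH_true _ _ _).2 ⟨k.isLt, by simp [hck]⟩
        · rw [← Bool.not_eq_true]
          intro hx
          obtain ⟨_, hx⟩ := (twH_true _ _ _).1 hx
          simp [hck] at hx
        · change twM t.1 (k.val + 1) c = twM t.1 k.val c + 1
          rw [hmk, if_pos hck.symm]
      · rintro ⟨-, -, -, hx⟩
        refine ⟨hc, ?_⟩
        change twM t.1 (k.val + 1) c = twM t.1 k.val c + 1 at hx
        rw [hmk] at hx
        by_contra hne
        rw [if_neg (by exact fun h => hne h.symm)] at hx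
        omega
  · have h1 : (twPhi t).h ⟨s.val, by omega⟩ c.castSucc = true :=
      (twH_true _ _ _).2 ⟨hs, by simp [hc]⟩
    have h2 : (twPhi t).h ⟨s.val, by omega⟩ c.succ = false := by
      rw [← Bool.not_eq_true]
      intro hx
      obtain ⟨_, hx⟩ := (twH_true _ _ _).1 hx
      simp [hc] at hx
    have h3 : (twPhi t).m (Fin.succ ⟨s.val, by omega⟩) c =
        (twPhi t).m (Fin.castSucc ⟨s.val, by omega⟩) c + 1 := by
      change twM t.1 (s.val + 1) c = twM t.1 s.val c + 1
      rw [hms, if_pos (by exact hc.symm)]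
    unfold twLocal
    simp only [h1, h2, h3, if_true]
    rw [hps, if_pos hc.le]
    simp [hc]
  · have h1 : (twPhi t).h ⟨s.val, by omega⟩ c.castSucc = false := by
      rw [← Bool.not_eq_true]
      intro hx
      obtain ⟨_, hx⟩ := (twH_true _ _ _).1 hx
      rw [Fin.lt_def] at hc
      simp at hx
      omega
    have h2 : (twPhi t).h ⟨s.val, by omega⟩ c.succ = false := by
      rw [← Bool.not_eq_true]
      intro hx
      obtain ⟨_, hx⟩ := (twH_true _ _ _).1 hx
      rw [Fin.lt_def] at hc
      simp [Fin.le_def] at hx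
      omega
    have h3 : (twPhi t).m (Fin.castSucc ⟨s.val, by omega⟩) c =
        (twPhi t).m (Fin.succ ⟨s.val, by omega⟩) c := by
      change twM t.1 s.val c = twM t.1 (s.val + 1) c
      rw [hms, if_neg (by exact hc.ne), add_zero]
    unfold twLocal
    simp only [h1, h2, h3, if_true]
    rw [if_neg (not_le.2 hc)]
    simp [not_lt.2 hc.le]

lemma twLocal_ge {F : Type} [Field F] {r : ℕ} {lam : Fin r → ℕ} {L : ℕ}
    (q : F) (p : Fin (2*r) → F) (t : TwT r lam L) (s : Fin (2*r)) (hs : r ≤ s.val)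
    (c : Fin (L+1)) : twLocal q p (twPhi t) s c = 1 := by
  have h0 : ∀ j, (twPhi t).h s j = false := fun j => by
    change twH _ _ _ = _
    simp [twH, hs]
  have h3 : (twPhi t).m (Fin.castSucc s) c = (twPhi t).m (Fin.succ s) c :=
    (twM_succ_ge t.1 s.val hs c).symm
  unfold twLocal
  simp only [h0, h3, if_true]

lemma tw_weight {F : Type} [Field F] {r : ℕ} {lam : Fin r → ℕ} {L : ℕ}
    (q : F) (y : Fin r → F)
    (p : Fin (2*r) → F) (hp : ∀ (s : Fin (2*r)) (hs : s.val < r), p s = y ⟨s.val, hs⟩)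
    (t : TwT r lam L) :
    ∏ s : Fin (2*r), ∏ c : Fin (L+1), twLocal q p (twPhi t) s c
      = twW q y (fun s => (t.1 s).val) := by
  have h1 : ∏ s : Fin r, ∏ c : Fin (L+1), twLocal q p (twPhi t) ⟨s.val, by omega⟩ c =
      ∏ s : Fin (2*r), ∏ c : Fin (L+1), twLocal q p (twPhi t) s c := by
    apply Fintype.prod_of_injective (fun k : Fin r => (⟨k.val, by omega⟩ : Fin (2*r)))
    · intro a b hab
      simpa [Fin.ext_iff] using hab
    · intro k hk
      have hk' : ¬ k.val < r := fun hlt => hk ⟨⟨k.val, hlt⟩, rfl⟩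
      exact Finset.prod_eq_one (fun c _ => twLocal_ge q p t k (by omega) c)
    · intro k
      rfl
  rw [← h1]
  unfold twW
  rw [← Finset.prod_mul_distrib]
  refine Finset.prod_congr rfl fun s _ => ?_
  simp only [twLocal_lt q y p hp t s]
  rw [Finset.prod_mul_distrib]
  congr 1
  · rw [← Finset.prod_filter, Finset.prod_const]
    congr 1
    have : Finset.univ.filter (fun c => c ≤ t.1 s) = Finset.Iic (t.1 s) := by
      ext c; simp
    rw [this, Fin.card_Iic]
  · rw [Finset.prod_comm]
    refine Finset.prod_congr rfl fun k _ => ?_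
    rw [Finset.prod_eq_single (t.1 k)]
    · simp
    · intro c _ hc
      rw [if_neg (fun h => hc h.2)]
    · simp

lemma tw_Z {F : Type} [Field F] {r : ℕ} {lam : Fin r → ℕ} {L : ℕ}
    (q : F) (y : Fin r → F)
    (p : Fin (2*r) → F) (hp : ∀ (s : Fin (2*r)) (hs : s.val < r), p s = y ⟨s.val, hs⟩) :
    ZTw r lam L q p = ∑ t : TwT r lam L, twW q y (fun s => (t.1 s).val) := by
  unfold ZTw
  have hsup : Function.support
      (fun st : TwState r lam L => ∏ s : Fin (2*r), ∏ c : Fin (L+1), twLocal q p st s c) ⊆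
      Set.range (twPhi : TwT r lam L → _) := by
    intro st hst
    rw [Function.mem_support, Finset.prod_ne_zero_iff] at hst
    exact tw_surj q p st fun s c =>
      (Finset.prod_ne_zero_iff.1 (hst s (Finset.mem_univ _))) c (Finset.mem_univ _)
  rw [← finsum_mem_univ, ← finsum_mem_inter_support, Set.univ_inter,
    ← Set.inter_eq_right.2 hsup, finsum_mem_inter_support, finsum_mem_range twPhi_injective,
    finsum_eq_sum_of_fintype]
  exact Finset.sum_congr rfl fun t _ => tw_weight q y p hp t

lemma tw_exists {r : ℕ} {κ : Type} [DecidableEq κ] (f g : Fin r → κ)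
    (h : ∀ c, (Finset.univ.filter (fun i => f i = c)).card =
      (Finset.univ.filter (fun i => g i = c)).card) :
    ∃ σ : Equiv.Perm (Fin r), ∀ i, f (σ i) = g i := by
  have e : ∀ c, Nonempty ({i // g i = c} ≃ {i // f i = c}) := fun c => by
    apply Fintype.card_eq.1
    rw [Fintype.card_subtype, Fintype.card_subtype, h]
  have e := fun c => (e c).some
  refine ⟨(Equiv.sigmaFiberEquiv g).symm.trans
    ((Equiv.sigmaCongrRight e).trans (Equiv.sigmaFiberEquiv f)), fun i => ?_⟩
  exact (e (g i) ⟨i, rfl⟩).2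

/-- The filling attached to a permutation. -/
def twF {r : ℕ} {lam : Fin r → ℕ} {L : ℕ} (hL : ∀ i, lam i ≤ L) (σ : Equiv.Perm (Fin r)) :
    TwT r lam L :=
  ⟨fun s => ⟨lam (σ.symm s), Nat.lt_succ_of_le (hL _)⟩, fun c => by
    refine Finset.card_equiv σ.symm fun i => ?_
    simp [Fin.ext_iff]⟩

lemma twF_fiber {r : ℕ} {lam : Fin r → ℕ} {L : ℕ} (hL : ∀ i, lam i ≤ L) (t : TwT r lam L) :
    (Finset.univ.filter (fun σ => twF hL σ = t)).card =
      Fintype.card {σ : Equiv.Perm (Fin r) // ∀ i, lam (σ i) = lam i} := by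
  have hmem : ∀ σ, twF hL σ = t ↔ ∀ i, (t.1 (σ i)).val = lam i := by
    intro σ
    constructor
    · rintro rfl i
      simp [twF]
    · intro h
      apply Subtype.ext
      funext s
      apply Fin.ext
      have := h (σ.symm s)
      rw [Equiv.apply_symm_apply] at this
      exact this.symm
  obtain ⟨σ₀, h0⟩ := tw_exists t.1 (fun i => (⟨lam i, Nat.lt_succ_of_le (hL i)⟩ : Fin (L+1)))
    (fun c => by rw [t.2 c]; congr 1; ext i; simp [Fin.ext_iff])
  have h0' : ∀ i, (t.1 (σ₀ i)).val = lam i := fun i => by rw [h0]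
  rw [Fintype.card_subtype]
  symm
  refine Finset.card_equiv (Equiv.mulLeft σ₀) fun τ => ?_
  simp only [Finset.mem_filter, Finset.mem_univ, true_and, hmem, Equiv.coe_mulLeft,
    Equiv.Perm.mul_apply, h0']

/-- Evaluation of the twisted column operators (Theorem 4.1). -/
theorem stmt9 (r : ℕ) (hr : 0 < r) (lam : Fin r → ℕ)
    (hlam : ∀ j k : Fin r, j ≤ k → lam k ≤ lam j)
    (F : Type) [Field F] (q : F) (y : Fin r → F)
    (hy : Function.Injective y) (hy0 : ∀ i, y i ≠ 0)
    (p : Fin (2*r) → F) (hp : ∀ (s : Fin (2*r)) (hs : s.val < r), p s = y ⟨s.val, hs⟩) :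
    (Fintype.card {σ : Equiv.Perm (Fin r) // ∀ i, lam (σ i) = lam i} : F) *
        ZTw r lam (lam ⟨0, hr⟩) q p
      = ∑ σ : Equiv.Perm (Fin r),
          (∏ i : Fin r, y (σ i) ^ (lam i + 1)) *
          ∏ i : Fin r, ∏ j : Fin r,
            if lam i < lam j then (y (σ j) - q * y (σ i)) / (y (σ j) - y (σ i)) else 1 := by
  have hL : ∀ i, lam i ≤ lam ⟨0, hr⟩ := fun i => hlam _ _ (by rw [Fin.le_def]; exact Nat.zero_le _)
  rw [tw_Z q y p hp]
  have hs : ∀ σ : Equiv.Perm (Fin r), (∏ i : Fin r, y (σ i) ^ (lam i + 1)) *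
          (∏ i : Fin r, ∏ j : Fin r,
            if lam i < lam j then (y (σ j) - q * y (σ i)) / (y (σ j) - y (σ i)) else 1) =
      twW q y (fun s => ((twF hL σ).1 s).val) := by
    intro σ
    unfold twW
    rw [Finset.prod_comm]
    congr 1
    · refine Fintype.prod_equiv σ _ _ fun i => ?_
      simp [twF]
    · refine Fintype.prod_equiv σ _ _ fun j => ?_
      refine Fintype.prod_equiv σ _ _ fun i => ?_
      simp [twF]
  simp only [hs]
  rw [← Finset.sum_fiberwise Finset.univ (fun σ => twF hL σ), Finset.mul_sum]
  refine Finset.sum_congr rfl fun t _ => ?_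
  rw [Finset.sum_congr rfl (g := fun _ => twW q y (fun s => (t.1 s).val))
    (fun σ hσ => by rw [(Finset.mem_filter.1 hσ).2]), Finset.sum_const, twF_fiber hL t,
    nsmul_eq_mul]
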